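/- Let G be a finite p-solvable group that is minimal non-p-supersolvable (G is not p-supersolvable, but every proper subgroup of G is p-supersolvable). Let H be a proper subgroup of G^{𝔘_p} and B a subgroup of G with G = HB. Then B = G. -/

import Mathlib

open Subgroup Pointwise

/-- `A < B` is a chief factor of `G`. -/
def IsChiefFactor (G : Type*) [Group G] (A B : Subgroup G) : Prop :=
  A.Normal ∧ B.Normal ∧ A < B ∧
    ∀ N : Subgroup G, N.Normal → A ≤ N → N ≤ B → N = A ∨ N = B

/-- The order of the factor group `B/A`. -/
noncomputable def factorCard {G : Type*} [Group G] (A B : Subgroup G) : ℕ :=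
  Nat.card B / Nat.card A

/-- A finite group is `p`-solvable if every chief factor is a `p`-group or a `p'`-group. -/
def IsPSolvable (p : ℕ) (G : Type*) [Group G] : Prop :=
  ∀ A B : Subgroup G, IsChiefFactor G A B →
    (∃ n : ℕ, factorCard A B = p ^ n) ∨ ¬ p ∣ factorCard A B

/-- A finite group is `p`-supersolvable if it is `p`-solvable and every `p`-chief factor
has order `p`. -/
def IsPSupersolvable (p : ℕ) (G : Type*) [Group G] : Prop :=
  IsPSolvable p G ∧ ∀ A B : Subgroup G, IsChiefFactor G A B →
    p ∣ factorCard A B → factorCard A B = p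

/-- A finite group is `p`-nilpotent if it has a normal Hall `p'`-subgroup. -/
def IsPNilpotent (p : ℕ) (G : Type*) [Group G] : Prop :=
  ∃ H : Subgroup G, H.Normal ∧ ¬ p ∣ Nat.card H ∧ ∃ n : ℕ, H.index = p ^ n

/-- The quotient `G ⧸ N` is `p`-supersolvable (for `N` normal). -/
def QuotientIsPSupersolvable (p : ℕ) {G : Type*} [Group G] (N : Subgroup G) : Prop :=
  ∀ [N.Normal], IsPSupersolvable p (G ⧸ N)

/-- `R` is the `p`-supersolvable residual of `G`: the smallest normal subgroup with
`p`-supersolvable quotient. -/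
def IsPSupersolvableResidual (p : ℕ) {G : Type*} [Group G] (R : Subgroup G) : Prop :=
  R.Normal ∧ QuotientIsPSupersolvable p R ∧
    ∀ N : Subgroup G, N.Normal → QuotientIsPSupersolvable p N → R ≤ N

/-- the center `Z(K)` of a subgroup `K`, as a subgroup of the ambient group. -/
def centerOf {G : Type*} [Group G] (K : Subgroup G) : Subgroup G :=
  Subgroup.centralizer (K : Set G) ⊓ K

/-- `H` is c-embedded in `G` with respect to `K`: there is `B ≤ G` with `G = HB` and
`H ∩ B ≤ Z(K)`. -/
def IsCEmbedded {G : Type*} [Group G] (H K : Subgroup G) : Prop :=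
  ∃ B : Subgroup G, (∀ g : G, ∃ h ∈ H, ∃ b ∈ B, g = h * b) ∧ H ⊓ B ≤ centerOf K

/-- A group is quaternion-free if no section is isomorphic to the quaternion group `Q₈`. -/
def QuaternionFree (G : Type*) [Group G] : Prop :=
  ∀ (H : Subgroup G) (N : Subgroup H) [N.Normal], IsEmpty ((H ⧸ N) ≃* QuaternionGroup 2)

/-- the conjugate `P^x = x⁻¹ P x`. -/
def conjSub {G : Type*} [Group G] (P : Subgroup G) (x : G) : Subgroup G :=
  (MulAut.conj x⁻¹) • P

theorem factorCard_eq_relIndex {G : Type*} [Group G] [Finite G] {A B : Subgroup G} (h : A ≤ B) :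
    factorCard A B = A.relIndex B := by
  rw [factorCard, ← relIndex_bot_left A, ← relIndex_bot_left B,
    ← relIndex_mul_relIndex _ _ _ bot_le h, relIndex_bot_left]
  exact Nat.mul_div_cancel_left _ Nat.card_pos

theorem isPSupersolvable_iff {p : ℕ} {G : Type*} [Group G] [Finite G] :
    IsPSupersolvable p G ↔ ∀ A B : Subgroup G, IsChiefFactor G A B →
      ¬ p ∣ A.relIndex B ∨ A.relIndex B = p := by
  constructor
  · intro h A B hAB
    rw [← factorCard_eq_relIndex hAB.2.2.1.le]
    exact or_iff_not_imp_left.2 fun hd => h.2 A B hAB (not_not.1 hd)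
  · refine fun h => ⟨fun A B hAB => ?_, fun A B hAB hd => ?_⟩ <;>
      have := h A B hAB <;> rw [← factorCard_eq_relIndex hAB.2.2.1.le] at this
    · exact this.symm.imp_left fun h => ⟨1, by simpa using h⟩
    · exact this.resolve_left (not_not.2 hd)

theorem isChiefFactor_comap_iff {G G' : Type*} [Group G] [Group G'] {f : G →* G'}
    (hf : Function.Surjective f) {A B : Subgroup G'} :
    IsChiefFactor G (A.comap f) (B.comap f) ↔ IsChiefFactor G' A B := by
  have hn : ∀ C : Subgroup G', (C.comap f).Normal ↔ C.Normal := fun C =>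
    ⟨fun h => by simpa [map_comap_eq_self_of_surjective hf] using h.map f hf, fun h => h.comap f⟩
  simp only [IsChiefFactor, hn, comap_lt_comap_of_surjective hf]
  refine and_congr_right fun _ => and_congr_right fun _ => and_congr_right fun _ => ⟨?_, ?_⟩
  · intro h N hN hAN hNB
    have := h (N.comap f) (hN.comap f) (comap_mono hAN) (comap_mono hNB)
    simpa only [(comap_injective hf).eq_iff] using this
  · intro h N hN hAN hNB
    have hk : f.ker ≤ N := (comap_mono bot_le).trans hAN
    have hc : (N.map f).comap f = N := comap_map_eq_self hk
    have := h (N.map f) (hN.map f hf)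
      (by rwa [← comap_le_comap_of_surjective hf, hc])
      (by rwa [← comap_le_comap_of_surjective hf, hc])
    rw [← hc]
    simpa only [(comap_injective hf).eq_iff] using this

theorem relIndex_comap_comap {G G' : Type*} [Group G] [Group G'] {f : G →* G'}
    (hf : Function.Surjective f) (A B : Subgroup G') :
    (A.comap f).relIndex (B.comap f) = A.relIndex B := by
  rw [relIndex_comap, map_comap_eq_self_of_surjective hf]

theorem IsPSupersolvable.of_surjective {p : ℕ} {G G' : Type*} [Group G] [Finite G]
    [Group G'] [Finite G'] (h : IsPSupersolvable p G) {f : G →* G'}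
    (hf : Function.Surjective f) : IsPSupersolvable p G' := by
  rw [isPSupersolvable_iff] at h ⊢
  intro A B hAB
  rw [← relIndex_comap_comap hf]
  exact h _ _ ((isChiefFactor_comap_iff hf).2 hAB)

theorem isPSupersolvable_quotient_iff {p : ℕ} {G : Type*} [Group G] [Finite G]
    (N : Subgroup G) [N.Normal] :
    IsPSupersolvable p (G ⧸ N) ↔ ∀ A B : Subgroup G, IsChiefFactor G A B → N ≤ A →
      ¬ p ∣ A.relIndex B ∨ A.relIndex B = p := by
  have hf := QuotientGroup.mk'_surjective N
  rw [isPSupersolvable_iff]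
  constructor
  · intro h A B hAB hNA
    have hc : ∀ C : Subgroup G, N ≤ C →
        (C.map (QuotientGroup.mk' N)).comap (QuotientGroup.mk' N) = C := fun C hC =>
      comap_map_eq_self (by simpa using hC)
    have hA := hc A hNA
    have hB := hc B (hNA.trans hAB.2.2.1.le)
    have := h (A.map (QuotientGroup.mk' N)) (B.map (QuotientGroup.mk' N))
      ((isChiefFactor_comap_iff hf).1 (by rwa [hA, hB]))
    rwa [← relIndex_comap_comap hf, hA, hB] at this
  · intro h A B hAB
    rw [← relIndex_comap_comap hf]
    exact h _ _ ((isChiefFactor_comap_iff hf).2 hAB)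
      (by simpa using (QuotientGroup.mk' N).ker_le_comap A)

theorem sup_inf_of_le_of_normal {G : Type*} [Group G] {A B R : Subgroup G} [R.Normal]
    (h : A ≤ B) : (A ⊔ R) ⊓ B = A ⊔ R ⊓ B := by
  refine le_antisymm ?_ (sup_le (le_inf le_sup_left h) (inf_le_inf_right _ le_sup_right))
  rintro _ ⟨hx, hxB⟩
  obtain ⟨a, ha, r, hr, rfl⟩ := mem_sup_of_normal_right.1 hx
  exact mul_mem (mem_sup_left ha)
    (mem_sup_right ⟨hr, (mul_mem_cancel_left (h ha)).1 hxB⟩)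

theorem IsPSupersolvable.quotient_of_isChiefFactor {p : ℕ} {G : Type*} [Group G]
    [Finite G] {K R : Subgroup G} [hK : K.Normal] [hR : R.Normal] (hKR : IsChiefFactor G K R)
    (hc : ¬ p ∣ K.relIndex R ∨ K.relIndex R = p) (h : IsPSupersolvable p (G ⧸ R)) :
    IsPSupersolvable p (G ⧸ K) := by
  rw [isPSupersolvable_quotient_iff] at h ⊢
  intro A B hAB hKA
  obtain ⟨hA, hB, hlt, hmin⟩ := hAB
  rcases hKR.2.2.2 (R ⊓ A) inferInstance (le_inf hKR.2.2.1.le hKA) inf_le_left with hRA | hRA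
  swap
  · exact h A B ⟨hA, hB, hlt, hmin⟩ (inf_eq_left.1 hRA)
  rcases hKR.2.2.2 (R ⊓ B) inferInstance (le_inf hKR.2.2.1.le (hKA.trans hlt.le)) inf_le_left
    with hRB | hRB
  · have hAR : (A ⊔ R) ⊓ B = A := by
      rw [sup_inf_of_le_of_normal hlt.le, hRB, sup_eq_left.2 hKA]
    have hidx : (A ⊔ R).relIndex (B ⊔ R) = A.relIndex B := by
      rw [show B ⊔ R = B ⊔ (A ⊔ R) by rw [← sup_assoc, sup_eq_left.2 hlt.le], relIndex_sup_right,
        ← inf_relIndex_right, hAR]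
    rw [← hidx]
    refine h _ _ ⟨inferInstance, inferInstance, ?_, ?_⟩ le_sup_right
    · refine lt_of_le_of_ne (sup_le_sup_right hlt.le R) fun he => hlt.ne ?_
      rw [← hAR, he]
      exact inf_eq_right.2 le_sup_left
    · intro X hX hAX hXB
      have hX' : X = X ⊓ B ⊔ R := by
        refine le_antisymm (fun x hx => ?_) (sup_le inf_le_left (le_sup_right.trans hAX))
        obtain ⟨b, hb, r, hr, rfl⟩ := mem_sup_of_normal_right.1 (hXB hx)
        exact mul_mem (mem_sup_left
          ⟨(mul_mem_cancel_right (hAX (mem_sup_right hr))).1 hx, hb⟩) (mem_sup_right hr)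
      refine (hmin (X ⊓ B) inferInstance (le_inf (le_sup_left.trans hAX) hlt.le)
        inf_le_right).imp ?_ ?_ <;> intro he <;> rw [hX', he]
  · have hRB' : R ≤ B := inf_eq_left.1 hRB
    have hAR : A ⊔ R = B := by
      refine (hmin (A ⊔ R) inferInstance le_sup_left (sup_le hlt.le hRB')).resolve_left fun he => ?_
      rw [inf_eq_left.2 (sup_eq_left.1 he)] at hRA
      exact hKR.2.2.1.ne hRA.symm
    rwa [← hAR, relIndex_sup_left, ← inf_relIndex_left, hRA]

section Representation

variable {p : ℕ} [hp : Fact p.Prime] {V : Type*} [AddCommGroup V] [Module (ZMod p) V]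
  {Γ : Type*} [Group Γ]

theorem Representation.exists_character (ρ : Representation (ZMod p) Γ V) {k : V} (hk : k ≠ 0)
    (hinv : ∀ γ, ρ γ k ∈ Submodule.span (ZMod p) {k}) :
    ∃ χ : Γ →* ZMod p, ∀ γ, ρ γ k = χ γ • k := by
  choose χ hχ using fun γ => Submodule.mem_span_singleton.1 (hinv γ)
  have hinj := smul_left_injective (ZMod p) hk
  refine ⟨{ toFun := χ, map_one' := hinj ?_, map_mul' := fun a b => hinj ?_ }, fun γ => (hχ γ).symm⟩
  · simp [hχ]
  · simp only [hχ, map_mul, Module.End.mul_apply, mul_smul]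
    rw [← hχ b, map_smul, ← hχ a, smul_comm]

/-- If a line with character `χ` lies above every proper subrepresentation, then normal
`p'`-subgroups act through `χ`. -/
theorem Representation.apply_eq_smul_of_normal [Finite Γ] (ρ : Representation (ZMod p) Γ V)
    {k : V} (hk : k ≠ 0) {χ : Γ →* ZMod p} (hχ : ∀ γ, ρ γ k = χ γ • k)
    (hmax : ∀ W : Submodule (ZMod p) V, (∀ γ, W ≤ W.comap (ρ γ)) → W ≠ ⊤ →
      W ≤ Submodule.span (ZMod p) {k})
    (N : Subgroup Γ) [hN : N.Normal] (hpN : ¬ p ∣ Nat.card N) {n : Γ} (hn : n ∈ N) (v : V) :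
    ρ n v = χ n • v := by
  have := Fintype.ofFinite N
  have hinv (γ : Γ) : χ γ⁻¹ * χ γ = 1 := by rw [← map_mul, inv_mul_cancel, map_one]
  let ν : Module.End (ZMod p) V := ∑ m : N, χ (m : Γ)⁻¹ • ρ m
  have hν (x : V) : ν x = ∑ m : N, χ (m : Γ)⁻¹ • ρ m x := by simp [ν, LinearMap.sum_apply]
  have hνk : ν k = (Nat.card N : ZMod p) • k := by
    simp only [hν, hχ, smul_smul, hinv, one_smul, Finset.sum_const, Finset.card_univ,
      Nat.card_eq_fintype_card, Nat.cast_smul_eq_nsmul]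
  have hcard : (Nat.card N : ZMod p) ≠ 0 := by rwa [Ne, ZMod.natCast_eq_zero_iff]
  have hνγ (γ : Γ) (x : V) : ν (ρ γ x) = ρ γ (ν x) := by
    simp only [hν, map_sum, map_smul]
    refine Fintype.sum_equiv (MulAut.conjNormal γ⁻¹).toEquiv _ _ fun m => ?_
    simp only [MulEquiv.toEquiv_eq_coe, MulEquiv.coe_toEquiv, MulAut.conjNormal_apply,
      ← Module.End.mul_apply, ← map_mul]
    congr 1
    · simp only [mul_inv_rev, map_mul, inv_inv]
      rw [mul_left_comm, hinv, mul_one]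
    · simp [mul_assoc]
  have hker : LinearMap.ker ν = ⊥ := by
    have hle := hmax (LinearMap.ker ν)
      (fun γ x hx => by
        rw [Submodule.mem_comap, LinearMap.mem_ker, hνγ, LinearMap.mem_ker.1 hx, map_zero])
      (fun h => by
        have : ν k = 0 := LinearMap.mem_ker.1 (h ▸ Submodule.mem_top)
        exact smul_ne_zero hcard hk (hνk ▸ this))
    refine (Submodule.eq_bot_iff _).2 fun x hx => ?_
    obtain ⟨c, rfl⟩ := Submodule.mem_span_singleton.1 (hle hx)
    rw [LinearMap.mem_ker, map_smul, hνk] at hx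
    have hc := (smul_eq_zero.1 hx).resolve_right (smul_ne_zero hcard hk)
    rw [hc, zero_smul]
  refine LinearMap.ker_eq_bot.1 hker ?_
  rw [map_smul, hν, hν, Finset.smul_sum]
  refine Fintype.sum_equiv (Equiv.mulRight ⟨n, hn⟩) _ _ fun m => ?_
  simp only [Equiv.coe_mulRight, Subgroup.coe_mul, smul_smul, ← Module.End.mul_apply, ← map_mul]
  rw [mul_inv_rev, mul_inv_cancel_left]

theorem Representation.finrank_le_two_of_orderOf_eq [Module.Finite (ZMod p) V]
    (ρ : Representation (ZMod p) Γ V) (hρ : Function.Injective ρ) {k : V}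
    (hmax : ∀ W : Submodule (ZMod p) V, (∀ γ, W ≤ W.comap (ρ γ)) → W ≠ ⊤ →
      W ≤ Submodule.span (ZMod p) {k})
    {n : Γ} (hn : orderOf n = p) (hN : (Subgroup.zpowers n).Normal) :
    Module.finrank (ZMod p) V ≤ 2 := by
  have hn1 : n ≠ 1 := fun h => hp.out.one_lt.ne (by rw [← hn, h, orderOf_one])
  have hnf : IsOfFinOrder n := orderOf_pos_iff.1 (hn ▸ hp.out.pos)
  have hconj (γ : Γ) : ∃ a : ℕ, n ^ a = γ * n * γ⁻¹ :=
    hnf.mem_powers_iff_mem_zpowers.2 (hN.conj_mem n (Subgroup.mem_zpowers n) γ)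
  have hτ0 : ρ n ≠ 1 := fun h => hn1 (hρ (h.trans (map_one ρ).symm))
  have : Nontrivial V := by
    by_contra h
    rw [not_nontrivial_iff_subsingleton] at h
    exact hτ0 (Subsingleton.elim _ _)
  have : CharP (Module.End (ZMod p) V) p := charP_of_injective_algebraMap
    (algebraMap (ZMod p) (Module.End (ZMod p) V)).injective p
  have hxn : n ^ p = 1 := orderOf_dvd_iff_pow_eq_one.1 hn.dvd
  have hpow : (ρ n - 1) ^ p = 0 := by
    rw [sub_pow_char_of_commute p (Commute.one_right _), ← map_pow, one_pow, hxn, map_one,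
      sub_self]
  have hspan : Module.finrank (ZMod p) (Submodule.span (ZMod p) {k}) ≤ 1 :=
    (finrank_span_le_card _).trans (by simp)
  have hker : LinearMap.ker (ρ n - 1) ≤ Submodule.span (ZMod p) {k} := by
    refine hmax _ (fun γ x hx => ?_) fun h => hτ0 (sub_eq_zero.1 (LinearMap.ker_eq_top.1 h))
    have hx' : ρ n x = x := sub_eq_zero.1 hx
    obtain ⟨a, ha⟩ := hconj γ⁻¹
    have hpx : ρ (n ^ a) x = x := by
      rw [map_pow, Module.End.pow_apply]
      exact Function.iterate_fixed hx' a
    have : n * γ = γ * n ^ a := by rw [ha]; group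
    rw [Submodule.mem_comap, LinearMap.mem_ker, LinearMap.sub_apply, Module.End.one_apply,
      ← Module.End.mul_apply, ← map_mul, this, map_mul, Module.End.mul_apply, hpx, sub_self]
  have hrange : LinearMap.range (ρ n - 1) ≤ Submodule.span (ZMod p) {k} := by
    refine hmax _ ?_ fun h => ?_
    · rintro γ _ ⟨w, rfl⟩
      obtain ⟨a, ha⟩ := hconj γ
      have h1 : ρ γ * (ρ n - 1) = (ρ n - 1) * (∑ i ∈ Finset.range a, ρ n ^ i) * ρ γ := by
        rw [mul_geom_sum, ← map_pow, ha, mul_sub, sub_mul, ← map_mul, ← map_mul]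
        simp
      rw [Submodule.mem_comap, ← Module.End.mul_apply, h1, mul_assoc, Module.End.mul_apply]
      exact LinearMap.mem_range_self _ _
    · have hs : Function.Surjective ((ρ n - 1) ^ p : Module.End (ZMod p) V) := by
        rw [Module.End.coe_pow]
        exact (LinearMap.range_eq_top.1 h).iterate p
      obtain ⟨v, hv⟩ := exists_ne (0 : V)
      obtain ⟨w, hw⟩ := hs v
      rw [hpow] at hw
      exact hv hw.symm
  rw [← LinearMap.finrank_range_add_finrank_ker (ρ n - 1)]
  have := (Submodule.finrank_mono hker).trans hspan
  have := (Submodule.finrank_mono hrange).trans hspan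
  omega

theorem Representation.finrank_le_two [Finite Γ] [Finite V] (hΓ : IsPSupersolvable p Γ)
    (ρ : Representation (ZMod p) Γ V) (hρ : Function.Injective ρ) {k : V} (hk : k ≠ 0)
    (hinv : ∀ γ, ρ γ k ∈ Submodule.span (ZMod p) {k})
    (hmax : ∀ W : Submodule (ZMod p) V, (∀ γ, W ≤ W.comap (ρ γ)) → W ≠ ⊤ →
      W ≤ Submodule.span (ZMod p) {k}) :
    Module.finrank (ZMod p) V ≤ 2 := by
  obtain ⟨χ, hχ⟩ := ρ.exists_character hk hinv
  by_cases hC : χ.ker = ⊥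
  · have hcard : ¬ p ∣ Nat.card (⊤ : Subgroup Γ) := fun hd => by
      rw [Subgroup.card_top] at hd
      obtain ⟨x, hx⟩ := exists_prime_orderOf_dvd_card' p hd
      have h1 : χ x = 1 := by
        rw [← ZMod.pow_card (χ x), ← map_pow, orderOf_dvd_iff_pow_eq_one.1 hx.dvd, map_one]
      have : x = 1 := by
        rwa [← MonoidHom.mem_ker, hC, Subgroup.mem_bot] at h1
      rw [this, orderOf_one] at hx
      exact hp.out.one_lt.ne hx
    have hW (v : V) (hv : v ∉ Submodule.span (ZMod p) {k}) : Submodule.span (ZMod p) {v} = ⊤ := by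
      by_contra h
      refine hv (hmax _ (fun γ x hx => ?_) h (Submodule.mem_span_singleton_self v))
      rw [Submodule.mem_comap, ρ.apply_eq_smul_of_normal hk hχ hmax ⊤ hcard (Subgroup.mem_top γ)]
      exact Submodule.smul_mem _ _ hx
    have key : ∃ v : V, Submodule.span (ZMod p) {v} = ⊤ := by
      by_cases h : Submodule.span (ZMod p) {k} = ⊤
      · exact ⟨k, h⟩
      · obtain ⟨v, -, hv⟩ := SetLike.exists_of_lt (lt_top_iff_ne_top.2 h)
        exact ⟨v, hW v hv⟩
    obtain ⟨v, hv⟩ := key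
    rw [← finrank_top, ← hv]
    exact (finrank_span_le_card _).trans (by simp)
  · obtain ⟨N, ⟨hN, hNC, hN1⟩, hmin⟩ := exists_minimal_of_wellFoundedLT
      (fun N : Subgroup Γ => N.Normal ∧ N ≤ χ.ker ∧ N ≠ ⊥) ⟨χ.ker, inferInstance, le_rfl, hC⟩
    have hchief : IsChiefFactor Γ ⊥ N := by
      refine ⟨inferInstance, hN, bot_lt_iff_ne_bot.2 hN1, fun X hX _ hXN => ?_⟩
      by_contra! h
      exact h.2 (le_antisymm hXN (hmin ⟨hX, hXN.trans hNC, h.1⟩ hXN))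
    rcases isPSupersolvable_iff.1 hΓ _ _ hchief with h | h <;> rw [Subgroup.relIndex_bot_left] at h
    · refine absurd ((Subgroup.eq_bot_iff_forall N).2 fun n hn => hρ ?_) hN1
      ext v
      rw [ρ.apply_eq_smul_of_normal hk hχ hmax N h hn, MonoidHom.mem_ker.1 (hNC hn), map_one,
        one_smul, Module.End.one_apply]
    · obtain ⟨x, hx⟩ := exists_prime_orderOf_dvd_card' (G := N) p (h ▸ dvd_rfl)
      have hz : Subgroup.zpowers (x : Γ) = N := by
        refine Subgroup.eq_of_le_of_card_ge (by simp) ?_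
        rw [h, Nat.card_zpowers, Subgroup.orderOf_coe, hx]
      exact ρ.finrank_le_two_of_orderOf_eq hρ hmax (by rw [Subgroup.orderOf_coe, hx])
        (hz.symm ▸ hN)

end Representation

open scoped commutatorElement IsMulCommutative

theorem Subgroup.le_normalizer_of_conj_mem {G : Type*} [Group G] {S X : Subgroup G}
    (h : ∀ g ∈ S, ∀ x ∈ X, g * x * g⁻¹ ∈ X) : S ≤ normalizer (X : Set G) := fun g hg =>
  mem_normalizer_iff.2 fun x => ⟨h g hg x, fun hx => by
    simpa [mul_assoc] using h g⁻¹ (inv_mem hg) _ hx⟩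

/-- Automorphisms of an elementary abelian `p`-group, as linear endomorphisms over `ZMod p`. -/
def MulAut.toZModEnd (p : ℕ) (A : Type*) [CommGroup A] [Module (ZMod p) (Additive A)] :
    MulAut A →* Module.End (ZMod p) (Additive A) where
  toFun f := AddMonoidHom.toZModLinearMap p (MonoidHom.toAdditive f.toMonoidHom)
  map_one' := rfl
  map_mul' _ _ := rfl

theorem Subgroup.card_le_sq_of_isPSupersolvable_quotient {p : ℕ} [hp : Fact p.Prime] {G : Type*}
    [Group G] [Finite G] {K R : Subgroup G} [hKn : K.Normal] [R.Normal] [IsMulCommutative R]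
    [Module (ZMod p) (Additive R)] (hKR : K ≤ R) (hK : Nat.card K = p)
    (hmax : ∀ W : Subgroup G, W.Normal → W < R → W ≤ K)
    (hss : IsPSupersolvable p (G ⧸ R)) : Nat.card R ≤ p ^ 2 := by
  let ρ : G →* Module.End (ZMod p) (Additive R) :=
    (MulAut.toZModEnd p R).comp MulAut.conjNormal
  have hle : R ≤ ρ.ker.comap (MonoidHom.id G) := fun g hg => by
    have : (MulAut.conjNormal g : MulAut R) = 1 := MulEquiv.ext fun r => Subtype.ext <| by
      rw [MulAut.conjNormal_apply, setLike_mul_comm hg r.2,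
        mul_inv_cancel_right, MulAut.one_apply]
    change MulAut.toZModEnd p R (MulAut.conjNormal g) = 1
    rw [this, map_one]
  have hΓ : IsPSupersolvable p (G ⧸ ρ.ker) := hss.of_surjective
    (f := QuotientGroup.map R ρ.ker (MonoidHom.id G) hle)
    (QuotientGroup.map_surjective_of_surjective R ρ.ker (MonoidHom.id G)
      (QuotientGroup.mk'_surjective ρ.ker) hle)
  let σ : Representation (ZMod p) (G ⧸ ρ.ker) (Additive R) :=
    QuotientGroup.lift ρ.ker ρ fun _ h => h
  have hσ : Function.Injective σ := (injective_iff_map_eq_one σ).2 fun x => by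
    induction x using QuotientGroup.induction_on with
    | H g => exact fun h => (QuotientGroup.eq_one_iff g).2 h
  obtain ⟨⟨k, hkK⟩, hk⟩ := exists_prime_orderOf_dvd_card' (G := K) p hK.symm.dvd
  have hk : orderOf k = p := by rwa [← orderOf_mk]
  have hz : zpowers k = K := by
    refine eq_of_le_of_card_ge (by simpa using hkK) ?_
    rw [hK, Nat.card_zpowers, hk]
  let v : Additive R := Additive.ofMul ⟨k, hKR hkK⟩
  have hspan (r : R) (hr : (r : G) ∈ K) : Additive.ofMul r ∈ Submodule.span (ZMod p) {v} := by
    rw [← hz] at hr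
    obtain ⟨z, hz⟩ := hr
    rw [show r = (⟨k, hKR hkK⟩ : R) ^ z from Subtype.ext hz.symm, ofMul_zpow]
    exact zsmul_mem (Submodule.mem_span_singleton_self v) z
  have hfin := Representation.finrank_le_two hΓ σ hσ (k := v)
    (fun h => hp.out.one_lt.ne (by
      rw [← hk, show k = 1 from congrArg Subtype.val (ofMul_eq_zero.1 h), orderOf_one]))
    (fun γ => by
      induction γ using QuotientGroup.induction_on with
      | H g => exact hspan _ (hKn.conj_mem k hkK g))
    (fun W hW hWtop => by
      let W' : Subgroup G := (AddSubgroup.toSubgroup' W.toAddSubgroup).map R.subtype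
      have hmem (r : R) : (r : G) ∈ W' ↔ Additive.ofMul r ∈ W :=
        mem_map_iff_mem R.subtype_injective
      have hW'R : W' ≤ R := map_subtype_le _
      have hW'n : W'.Normal := ⟨fun x hx g => by
        let r : R := ⟨x, hW'R hx⟩
        exact (hmem (MulAut.conjNormal g r)).2 (hW (g : G ⧸ ρ.ker) ((hmem r).1 hx))⟩
      have hlt : W' < R := lt_of_le_of_ne hW'R fun he => hWtop <| by
        rw [eq_top_iff]
        rintro r -
        exact (hmem r.toMul).1 (he.ge r.toMul.2)
      exact fun x hx => hspan x.toMul (hmax W' hW'n hlt ((hmem x.toMul).2 hx)))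
  have hcard := Module.natCard_eq_pow_finrank (K := ZMod p) (V := Additive R)
  rw [Nat.card_zmod] at hcard
  exact hcard.trans_le (Nat.pow_le_pow_right hp.out.pos hfin)

theorem Subgroup.relIndex_le_of_isPSupersolvable_quotient {p : ℕ} [hp : Fact p.Prime] {G : Type*}
    [Group G] [Finite G] {E K R : Subgroup G} [E.Normal] [hKn : K.Normal] [hRn : R.Normal]
    (hEK : E ≤ K) (hKR : K ≤ R)
    (hcomm : ∀ r ∈ R, ∀ s ∈ R, ⁅r, s⁆ ∈ E) (hexp : ∀ r ∈ R, r ^ p ∈ E)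
    (hE : E.relIndex K = p) (hmax : ∀ W : Subgroup G, W.Normal → W < R → W ≤ K)
    (hss : IsPSupersolvable p (G ⧸ R)) : K.relIndex R ≤ p := by
  let f := QuotientGroup.mk' E
  have hf : Function.Surjective f := QuotientGroup.mk'_surjective E
  have hcard (A : Subgroup G) : Nat.card (A.map f) = E.relIndex A := by
    rw [← relIndex_ker, QuotientGroup.ker_mk']
  have hcomap {A : Subgroup G} (hA : E ≤ A) : (A.map f).comap f = A :=
    comap_map_eq_self (by simpa [f] using hA)
  have := hKn.map f hf
  have := hRn.map f hf
  have : IsMulCommutative (R.map f) := ⟨⟨by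
    rintro ⟨_, r, hr, rfl⟩ ⟨_, s, hs, rfl⟩
    refine Subtype.ext ?_
    change f r * f s = f s * f r
    rw [← commutatorElement_eq_one_iff_mul_comm, ← map_commutatorElement]
    exact (QuotientGroup.eq_one_iff _).2 (hcomm r hr s hs)⟩⟩
  let _ : Module (ZMod p) (Additive (R.map f)) := AddCommGroup.zmodModule (by
    rintro ⟨_, r, hr, rfl⟩
    exact Subtype.ext ((QuotientGroup.eq_one_iff (N := E) (r ^ p)).2 (hexp r hr)))
  have hsq : Nat.card (R.map f) ≤ p ^ 2 := by
    refine card_le_sq_of_isPSupersolvable_quotient (p := p) (map_mono hKR)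
      ((hcard K).trans hE) ?_ ?_
    · intro W hW hWR
      rw [← map_comap_eq_self_of_surjective hf W]
      refine map_mono (hmax _ (hW.comap f) ?_)
      rwa [← hcomap (hEK.trans hKR), comap_lt_comap_of_surjective hf]
    · exact hss.of_surjective (f := QuotientGroup.map R (R.map f) f (le_comap_map f R))
        (QuotientGroup.map_surjective_of_surjective _ _ _
          ((QuotientGroup.mk'_surjective _).comp hf) _)
  rw [hcard, ← relIndex_mul_relIndex E K R hEK hKR, hE, sq] at hsq
  exact Nat.le_of_mul_le_mul_left hsq hp.out.pos

theorem IsPGroup.exists_le_index_eq {p : ℕ} [hp : Fact p.Prime] {P : Type*} [Group P] [Finite P]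
    (hP : IsPGroup p P) {H : Subgroup P} (hH : H ≠ ⊤) :
    ∃ L : Subgroup P, H ≤ L ∧ L ≠ ⊤ ∧ (∀ r s : P, ⁅r, s⁆ ∈ L) ∧ ∀ r : P, r ^ p ∈ L := by
  obtain ⟨n, hn⟩ := IsPGroup.iff_card.1 hP
  obtain ⟨m, hm⟩ := IsPGroup.iff_card.1 (hP.to_subgroup H)
  have hlt : m < n := by
    rw [← Nat.pow_lt_pow_iff_right hp.out.one_lt, ← hm, ← hn]
    exact lt_of_le_of_ne (card_le_card_group H) fun h => hH ((card_eq_iff_eq_top H).1 h)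
  obtain ⟨L, hL, hHL⟩ := Sylow.exists_subgroup_card_pow_prime_le p
    (hn ▸ pow_dvd_pow p (Nat.sub_le n 1)) H hm (Nat.le_sub_one_of_lt hlt)
  have hidx : L.index = p := by
    refine Nat.eq_of_mul_eq_mul_left (Nat.card_pos (α := L)) ?_
    rw [card_mul_index, hn, hL, ← pow_succ, Nat.sub_add_cancel (Nat.one_le_of_lt hlt)]
  have : L.Normal := normal_of_index_eq_minFac_card (by
    rw [hidx, hn, Nat.Prime.pow_minFac hp.out (Nat.ne_zero_of_lt hlt)])
  refine ⟨L, hHL, fun h => ?_, fun r s => ?_, fun r => hidx ▸ pow_index_mem L r⟩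
  · rw [h, index_top] at hidx
    exact hp.out.one_lt.ne hidx
  · have := isCyclic_of_prime_card (α := P ⧸ L) (p := p) hidx
    rw [← QuotientGroup.eq_one_iff, ← QuotientGroup.mk'_apply, map_commutatorElement,
      commutatorElement_eq_one_iff_mul_comm]
    exact (IsCyclic.commGroup (α := P ⧸ L)).mul_comm _ _

theorem Subgroup.normal_of_sup_eq_top {G : Type*} [Group G] {S T X : Subgroup G} (h : S ⊔ T = ⊤)
    (hS : ∀ g ∈ S, ∀ x ∈ X, g * x * g⁻¹ ∈ X) (hT : ∀ g ∈ T, ∀ x ∈ X, g * x * g⁻¹ ∈ X) :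
    X.Normal :=
  normalizer_eq_top_iff.1 <| top_le_iff.1 <|
    h ▸ sup_le (le_normalizer_of_conj_mem hS) (le_normalizer_of_conj_mem hT)

theorem Subgroup.conj_mem_of_commutator_mem {G : Type*} [Group G] {X : Subgroup G} {g x : G}
    (h : ⁅g, x⁆ ∈ X) (hx : x ∈ X) : g * x * g⁻¹ ∈ X := by
  simpa [commutatorElement_def] using mul_mem h hx

theorem exists_isChiefFactor {G : Type*} [Group G] [Finite G] {E K : Subgroup G} [hE : E.Normal]
    [hK : K.Normal] (h : E < K) : ∃ N, E ≤ N ∧ IsChiefFactor G N K := by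
  obtain ⟨N, ⟨hN, hEN, hNK⟩, hmax⟩ := exists_maximal_of_wellFoundedGT
    (fun N : Subgroup G => N.Normal ∧ E ≤ N ∧ N < K) ⟨E, hE, le_rfl, h⟩
  refine ⟨N, hEN, hN, hK, hNK, fun X hX hNX hXK => ?_⟩
  rcases hXK.eq_or_lt with h | h
  · exact .inr h
  · exact .inl ((hmax ⟨hX, hEN.trans hNX, h⟩ hNX).antisymm hNX)

theorem IsPSupersolvableResidual.le_of_sup_eq_top {p : ℕ} {G : Type*} [Group G] [Finite G]
    {R N M : Subgroup G} (hR : IsPSupersolvableResidual p R) (hM : IsPSupersolvable p M)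
    (hN : N.Normal) (h : N ⊔ M = ⊤) : R ≤ N := by
  refine hR.2.2 N hN (hM.of_surjective (f := (QuotientGroup.mk' N).comp M.subtype) fun x => ?_)
  obtain ⟨g, rfl⟩ := QuotientGroup.mk'_surjective N x
  obtain ⟨n, hn, m, hm, rfl⟩ := mem_sup_of_normal_left.1 (h ▸ mem_top g : g ∈ N ⊔ M)
  exact ⟨⟨m, hm⟩, by simpa using hn⟩

/-- A chief factor centralised by `R` is a chief factor of any supplement of `R` covering it. -/
theorem IsChiefFactor.relIndex_of_supplement {p : ℕ} {G : Type*} [Group G] [Finite G]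
    {E K R M : Subgroup G} (hEK : IsChiefFactor G E K) (hKM : K ≤ M) (hRM : R ⊔ M = ⊤)
    (hcomm : ∀ r ∈ R, ∀ k ∈ K, ⁅r, k⁆ ∈ E) (hM : IsPSupersolvable p M) :
    ¬ p ∣ E.relIndex K ∨ E.relIndex K = p := by
  obtain ⟨hE, hK, hlt, hmin⟩ := hEK
  have hEM := hlt.le.trans hKM
  rw [← relIndex_subgroupOf hKM]
  refine isPSupersolvable_iff.1 hM _ _ ⟨inferInstance, inferInstance, ?_, fun N hN hEN hNK => ?_⟩
  · exact lt_of_le_of_ne (comap_mono hlt.le) fun h =>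
      hlt.ne (by simpa [subgroupOf_inj, hEM, hKM] using h)
  · have hEX : E ≤ N.map M.subtype := by
      simpa [hEM] using map_mono (f := M.subtype) hEN
    have hXK : N.map M.subtype ≤ K := by
      simpa [hKM] using map_mono (f := M.subtype) hNK
    have hX : (N.map M.subtype).Normal := by
      refine normal_of_sup_eq_top hRM (fun g hg x hx => ?_) (fun g hg => ?_)
      · exact conj_mem_of_commutator_mem (hEX (hcomm g hg x (hXK hx))) hx
      · rintro _ ⟨x, hx, rfl⟩
        exact ⟨_, hN.conj_mem x hx ⟨g, hg⟩, rfl⟩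
    have hN' : N = (N.map M.subtype).subgroupOf M :=
      (comap_map_eq_self_of_injective M.subtype_injective N).symm
    refine (hmin _ hX hEX hXK).imp ?_ ?_ <;> intro h <;> rw [hN', h]

theorem IsPSupersolvableResidual.isPGroup {p : ℕ} [hp : Fact p.Prime] {G : Type*} [Group G]
    [Finite G] (hmin : ∀ M : Subgroup G, M < ⊤ → IsPSupersolvable p M) {K R M : Subgroup G}
    (hR : IsPSupersolvableResidual p R) (hKR : IsChiefFactor G K R) {n : ℕ}
    (hn : K.relIndex R = p ^ n) (hKM : K ≤ M) (hM : M ≠ ⊤) (hRM : R ⊔ M = ⊤) :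
    IsPGroup p R := by
  have := hR.1
  have := hKR.1
  have hle {N T : Subgroup G} (hN : N.Normal) (hT : T ≠ ⊤) (h : N ⊔ T = ⊤) : R ≤ N :=
    hR.le_of_sup_eq_top (hmin T hT.lt_top) hN h
  obtain ⟨P⟩ : Nonempty (Sylow p R) := inferInstance
  let Q : Subgroup G := (P : Subgroup R).map R.subtype
  have hQR : Q ≤ R := map_subtype_le _
  have hQK : Q ⊔ K = R := by
    refine le_antisymm (sup_le hQR hKR.2.2.1.le) (relIndex_eq_one.1 ?_)
    have h1 : (Q ⊔ K).relIndex R ∣ p ^ n := hn ▸ relIndex_dvd_of_le_left R le_sup_right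
    have h2 : (Q ⊔ K).relIndex R ∣ (P : Subgroup R).index := by
      have : Q.relIndex R = (P : Subgroup R).index := by
        rw [relIndex, subgroupOf, comap_map_eq_self_of_injective R.subtype_injective]
      exact this ▸ relIndex_dvd_of_le_left R le_sup_left
    exact Nat.eq_one_of_dvd_coprimes
      (Nat.Coprime.pow_left n ((Nat.Prime.coprime_iff_not_dvd hp.out).2 P.not_dvd_index)) h1 h2
  have hQn : Q.Normal := by
    rw [← normalizer_eq_top_iff]
    by_contra hne
    refine hKR.2.2.1.not_ge (hle hKR.1 hne ?_)
    rw [eq_top_iff, ← P.normalizer_sup_eq_top]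
    exact sup_le le_sup_right
      (hQK.ge.trans (sup_le (le_normalizer.trans le_sup_right) le_sup_left))
  have hRQ : R ≤ Q := hle hQn hM (by
    rw [← hRM, ← hQK, sup_assoc, sup_eq_right.2 hKM])
  exact (P.isPGroup'.map R.subtype).to_le hRQ

/-- A proper subgroup of a normal `p`-subgroup `R` lies in a proper subgroup of `R` whose core
contains all commutators and `p`-th powers. -/
theorem IsPGroup.exists_normal_of_lt {p : ℕ} [hp : Fact p.Prime] {G : Type*} [Group G] [Finite G]
    {H R : Subgroup G} [hRn : R.Normal] (hR : IsPGroup p R) (hH : H < R) :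
    ∃ L E : Subgroup G, H ≤ L ∧ L < R ∧ E.Normal ∧ E ≤ L ∧
      (∀ r ∈ R, ∀ s ∈ R, ⁅r, s⁆ ∈ E) ∧ ∀ r ∈ R, r ^ p ∈ E := by
  obtain ⟨L, hHL, hL, hcomm, hexp⟩ := hR.exists_le_index_eq (H := H.subgroupOf R)
    (by simpa using hH.not_ge)
  refine ⟨L.map R.subtype, (L.map R.subtype).normalCore, ?_, ?_, inferInstance, normalCore_le _,
    fun r hr s hs g => ?_, fun r hr g => ?_⟩
  · simpa [hH.le] using map_mono (f := R.subtype) hHL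
  · exact lt_of_le_of_ne (map_subtype_le _) fun h => hL (by
      rw [← comap_map_eq_self_of_injective R.subtype_injective L, h]; exact subgroupOf_self R)
  · exact ⟨_, hcomm ⟨_, hRn.conj_mem r hr g⟩ ⟨_, hRn.conj_mem s hs g⟩, by
      simp [commutatorElement_def, mul_assoc]⟩
  · exact ⟨_, hexp ⟨_, hRn.conj_mem r hr g⟩, by simp [conj_pow]⟩

/-- in a p-solvable minimal non-p-supersolvable group `G`, if `H < G^{𝔘_p}`
and `G = HB`, then `B = G`. -/
theorem stmt2 (p : ℕ) (hp : p.Prime) (G : Type*) [Group G] [Finite G]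
    (hsolv : IsPSolvable p G) (hns : ¬ IsPSupersolvable p G)
    (hmin : ∀ H : Subgroup G, H < ⊤ → IsPSupersolvable p H)
    (R : Subgroup G) (hR : IsPSupersolvableResidual p R)
    (H B : Subgroup G) (hH : H < R)
    (hGB : ∀ g : G, ∃ h ∈ H, ∃ b ∈ B, g = h * b) :
    B = ⊤ := by
  have : Fact p.Prime := ⟨hp⟩
  by_contra hB
  have hRn := hR.1
  have hle {N T : Subgroup G} (hN : N.Normal) (hT : T ≠ ⊤) (h : N ⊔ T = ⊤) : R ≤ N :=
    hR.le_of_sup_eq_top (hmin T hT.lt_top) hN h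
  have hRB : R ⊔ B = ⊤ := eq_top_iff.2 fun g _ => by
    obtain ⟨h, hh, b, hb, rfl⟩ := hGB g
    exact mul_mem_sup (hH.le hh) hb
  obtain ⟨K, -, hKR⟩ := exists_isChiefFactor (bot_le.trans_lt hH)
  have hKn := hKR.1
  have hlt := hKR.2.2.1
  obtain ⟨hdvd, hne⟩ : p ∣ K.relIndex R ∧ K.relIndex R ≠ p := by
    rw [← not_not (a := p ∣ _), ← not_or]
    exact fun h => hlt.not_ge (hR.2.2 K hKn (hR.2.1.quotient_of_isChiefFactor hKR h))
  obtain ⟨n, hn⟩ := (hsolv K R hKR).resolve_right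
    (by rwa [factorCard_eq_relIndex hlt.le, not_not])
  rw [factorCard_eq_relIndex hlt.le] at hn
  have hM : K ⊔ B ≠ ⊤ := fun h => hlt.not_ge (hle hKn hB h)
  have hRM : R ⊔ (K ⊔ B) = ⊤ := top_le_iff.1 (hRB ▸ sup_le_sup_left le_sup_right R)
  have hRp : IsPGroup p R := hR.isPGroup hmin hKR hn le_sup_left hM hRM
  have hmax (W : Subgroup G) (hW : W.Normal) (hWR : W < R) : W ≤ K := by
    rcases hKR.2.2.2 (K ⊔ W) inferInstance le_sup_left (sup_le hlt.le hWR.le) with h | h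
    · exact sup_eq_left.1 h
    · refine absurd (hle hW hM ?_) hWR.not_ge
      rw [← hRB, ← h, sup_left_comm, sup_assoc]
  obtain ⟨L, E, hHL, hLR, hEn, hEL, hcomm, hexp⟩ := hRp.exists_normal_of_lt hH
  have hEK : E < K := by
    refine lt_of_le_of_ne (hmax E hEn (hEL.trans_lt hLR)) ?_
    rintro rfl
    have hX : (R ⊓ B ⊔ E).Normal := by
      refine normal_of_sup_eq_top hRB (fun g hg x hx => ?_) (fun g hg x hx => ?_)
      · exact conj_mem_of_commutator_mem
          (mem_sup_right (hcomm g hg x (sup_le inf_le_left hlt.le hx))) hx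
      · obtain ⟨a, ha, e, he, rfl⟩ := mem_sup_of_normal_right.1 hx
        rw [← conj_mul]
        exact mul_mem (mem_sup_left ⟨hRn.conj_mem a ha.1 g,
          B.mul_mem (B.mul_mem hg ha.2) (B.inv_mem hg)⟩)
          (mem_sup_right (hEn.conj_mem e he g))
    have hXR : R ⊓ B ⊔ E < R := by
      refine lt_of_le_of_ne (sup_le inf_le_left hlt.le) fun h => hM ?_
      rw [← top_le_iff, ← hRB, ← h]
      exact sup_le (sup_le (inf_le_right.trans le_sup_right) le_sup_left) le_sup_right
    refine hLR.not_ge fun r hr => ?_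
    obtain ⟨h, hh, b, hb, rfl⟩ := hGB r
    exact mul_mem (hHL hh) (hEL (hmax _ hX hXR (mem_sup_left
      ⟨(mul_mem_cancel_left (hH.le hh)).1 hr, hb⟩)))
  obtain ⟨N, hEN, hNK⟩ := exists_isChiefFactor hEK
  have hNn := hNK.1
  have hidx : N.relIndex K = p := by
    refine (hNK.relIndex_of_supplement le_sup_left hRM
      (fun r hr k hk => hEN (hcomm r hr k (hlt.le hk)))
      (hmin _ hM.lt_top)).resolve_left (not_not.2 ?_)
    obtain ⟨m, hm⟩ := IsPGroup.iff_card.1 (hRp.to_le hlt.le)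
    obtain ⟨j, -, hj⟩ := (Nat.dvd_prime_pow hp).1 (hm ▸ relIndex_dvd_card N K)
    refine hj ▸ dvd_pow_self p fun h0 => hNK.2.2.1.not_ge (relIndex_eq_one.1 ?_)
    rw [hj, h0, pow_zero]
  have hKp := relIndex_le_of_isPSupersolvable_quotient hNK.2.2.1.le hlt.le
    (fun r hr s hs => hEN (hcomm r hr s hs)) (fun r hr => hEN (hexp r hr)) hidx hmax hR.2.1
  exact hne (hKp.antisymm (Nat.le_of_dvd (hn ▸ pow_pos hp.pos n) hdvd))
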